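/- arXiv:math/0105223 — 2 statements merged into one kernel-verified Lean document; each statement's English description precedes it below -/
import Mathlib

section
/- For a single dependent variable and one independent variable (m = n = 1): a jet function L(x, φ, φ_1, …, φ_N) satisfies E(L) = 0 identically, where E(L) = Σ_{k≥0} (−1)^k D^k(∂L/∂φ_k), if and only if L = D F for some jet function F. -/
open scoped BigOperators

/-- The jet space of curves: one independent variable `x` and the jet
coordinates `φ_0 = φ, φ_1, φ_2, …`. -/
abbrev J1 := ℝ × (ℕ → ℝ)

/-- Partial derivative with respect to `x`. -/
noncomputable def pdx1 (f : J1 → ℝ) (p : J1) : ℝ :=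
  deriv (fun t => f (t, p.2)) p.1

/-- Partial derivative with respect to `φ_k`. -/
noncomputable def pdphi1 (k : ℕ) (f : J1 → ℝ) (p : J1) : ℝ :=
  deriv (fun t => f (p.1, Function.update p.2 k t)) (p.2 k)

/-- The total derivative `D f = ∂f/∂x + Σ_k φ_{k+1} ∂f/∂φ_k`. -/
noncomputable def D1 (f : J1 → ℝ) (p : J1) : ℝ :=
  pdx1 f p + ∑' k : ℕ, p.2 (k + 1) * pdphi1 k f p

/-- A jet function: a smooth function of `x` and finitely many `φ_k`. -/
def IsJetFun1 (f : J1 → ℝ) : Prop :=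
  ∃ (N : ℕ) (F : ℝ × (Fin N → ℝ) → ℝ),
    ContDiff ℝ (⊤ : ℕ∞) F ∧ ∀ p, f p = F (p.1, fun i => p.2 i)

/-- The Euler operator `E(L) = Σ_k (−1)^k D^k (∂L/∂φ_k)`. -/
noncomputable def euler1 (L : J1 → ℝ) (p : J1) : ℝ :=
  ∑' k : ℕ, (-1 : ℝ) ^ k * (D1^[k] (pdphi1 k L)) p

open scoped ContDiff

section ParametricIntegral

universe u

variable {E G : Type u} [NormedAddCommGroup E] [NormedSpace ℝ E] [FiniteDimensional ℝ E]
  [NormedAddCommGroup G] [NormedSpace ℝ G]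

/-- Differentiation under the integral sign for a `C¹` integrand on a compact interval. -/
theorem hasFDerivAt_intervalIntegral_of_contDiff {F : E × ℝ → G} (hF : ContDiff ℝ 1 F)
    (a b : ℝ) (y : E) :
    HasFDerivAt (fun y => ∫ t in a..b, F (y, t))
      (∫ t in a..b, (fderiv ℝ F (y, t)).comp (ContinuousLinearMap.inl ℝ E ℝ)) y := by
  have hF' : Continuous fun q : E × ℝ =>
      (fderiv ℝ F q).comp (ContinuousLinearMap.inl ℝ E ℝ) :=
    (hF.continuous_fderiv one_ne_zero).clm_comp continuous_const
  obtain ⟨C, hC⟩ := ((isCompact_closedBall y 1).prod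
    (isCompact_uIcc (a := a) (b := b))).exists_bound_of_continuousOn hF'.continuousOn
  have hFc := hF.continuous
  refine intervalIntegral.hasFDerivAt_integral_of_dominated_of_fderiv_le
    (F := fun y t => F (y, t)) (bound := fun _ => C)
    (F' := fun y t => (fderiv ℝ F (y, t)).comp (ContinuousLinearMap.inl ℝ E ℝ))
    (Metric.closedBall_mem_nhds y one_pos) ?_ ?_ ?_ ?_ ?_ ?_
  · exact Filter.Eventually.of_forall fun z =>
      (hFc.comp (Continuous.prodMk_right z)).aestronglyMeasurable
  · exact (hFc.comp (Continuous.prodMk_right y)).intervalIntegrable _ _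
  · exact (hF'.comp (Continuous.prodMk_right y)).aestronglyMeasurable
  · exact Filter.Eventually.of_forall fun t ht z hz =>
      hC (z, t) ⟨hz, Set.uIoc_subset_uIcc ht⟩
  · exact intervalIntegrable_const
  · refine Filter.Eventually.of_forall fun t _ z _ => ?_
    exact ((hF.differentiable one_ne_zero) (z, t)).hasFDerivAt.comp z (hasFDerivAt_prodMk_left z t)

theorem contDiff_intervalIntegral_nat (n : ℕ) {G : Type u} [NormedAddCommGroup G]
    [NormedSpace ℝ G] {F : E × ℝ → G} (hF : ContDiff ℝ ∞ F) (a b : ℝ) :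
    ContDiff ℝ n fun y => ∫ t in a..b, F (y, t) := by
  have hF1 : ContDiff ℝ 1 F := hF.of_le (by exact_mod_cast le_top)
  induction n generalizing G with
  | zero =>
    exact contDiff_zero.2 (continuous_iff_continuousAt.2 fun y =>
      (hasFDerivAt_intervalIntegral_of_contDiff hF1 a b y).continuousAt)
  | succ n ih =>
    refine contDiff_succ_iff_hasFDerivAt.2
      ⟨_, ?_, fun y => hasFDerivAt_intervalIntegral_of_contDiff hF1 a b y⟩
    have hF' : ContDiff ℝ ∞ fun q : E × ℝ =>
        (fderiv ℝ F q).comp (ContinuousLinearMap.inl ℝ E ℝ) :=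
      (hF.fderiv_right le_rfl).clm_comp contDiff_const
    exact ih hF' (hF'.of_le (by exact_mod_cast le_top))

theorem contDiff_intervalIntegral {F : E × ℝ → G} (hF : ContDiff ℝ ∞ F) (a b : ℝ) :
    ContDiff ℝ ∞ fun y => ∫ t in a..b, F (y, t) :=
  contDiff_infty.2 fun n => contDiff_intervalIntegral_nat n hF a b

end ParametricIntegral

/-- The truncation of the jet space to the coordinates `x, φ_0, …, φ_{N-1}`. -/
def jetTrunc (N : ℕ) (p : J1) : ℝ × (Fin N → ℝ) := (p.1, fun i => p.2 i)

/-- The coordinate direction of `φ_k` in the truncated jet space; zero if `N ≤ k`. -/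
def jetDir (N k : ℕ) : ℝ × (Fin N → ℝ) := (0, fun i => if (i : ℕ) = k then 1 else 0)

/-- `F` represents the jet function `f` on the jets of order less than `N`. -/
structure JetRep (f : J1 → ℝ) (N : ℕ) (F : ℝ × (Fin N → ℝ) → ℝ) : Prop where
  contDiff : ContDiff ℝ ∞ F
  eq : ∀ p, f p = F (jetTrunc N p)

theorem isJetFun1_iff_exists_jetRep {f : J1 → ℝ} :
    IsJetFun1 f ↔ ∃ N F, JetRep f N F :=
  ⟨fun ⟨N, F, h, e⟩ => ⟨N, F, h, e⟩, fun ⟨N, F, h⟩ => ⟨N, F, h.contDiff, h.eq⟩⟩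

theorem jetDir_eq_zero {N k : ℕ} (h : N ≤ k) : jetDir N k = 0 := by
  ext i
  · rfl
  · have : (i : ℕ) ≠ k := by omega
    simp [jetDir, this]

theorem sum_smul_jetDir (N : ℕ) (c : ℕ → ℝ) :
    ∑ k ∈ Finset.range N, c k • jetDir N k = (0, fun i : Fin N => c i) := by
  ext i
  · simp [jetDir, Prod.fst_sum]
  · simp [jetDir, Prod.snd_sum]

namespace JetRep

variable {f g : J1 → ℝ} {N : ℕ} {F G : ℝ × (Fin N → ℝ) → ℝ}

theorem isJetFun1 (h : JetRep f N F) : IsJetFun1 f := ⟨N, F, h.contDiff, h.eq⟩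

theorem differentiable (h : JetRep f N F) : Differentiable ℝ F :=
  h.contDiff.differentiable (by simp)

theorem exists_of_le (h : JetRep f N F) {M : ℕ} (hNM : N ≤ M) : ∃ F', JetRep f M F' :=
  ⟨fun y => F (y.1, fun i => y.2 (Fin.castLE hNM i)),
    h.contDiff.comp (by fun_prop), fun p => h.eq p⟩

theorem hasDerivAt_phi (h : JetRep f N F) (k : ℕ) (p : J1) :
    HasDerivAt (fun t => f (p.1, Function.update p.2 k t))
      (fderiv ℝ F (jetTrunc N p) (jetDir N k)) (p.2 k) := by
  have hpath : ∀ t, jetTrunc N (p.1, Function.update p.2 k t)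
      = jetTrunc N p + (t - p.2 k) • jetDir N k := by
    intro t
    ext i
    · simp [jetTrunc, jetDir]
    · by_cases hi : (i : ℕ) = k
      · simp [jetTrunc, jetDir, ← hi]
      · simp [jetTrunc, jetDir, hi]
  have hd : HasDerivAt (fun t => jetTrunc N p + (t - p.2 k) • jetDir N k) (jetDir N k) (p.2 k) := by
    simpa using (((hasDerivAt_id (p.2 k)).sub_const (p.2 k)).smul_const
      (jetDir N k)).const_add (jetTrunc N p)
  have hF : HasFDerivAt F (fderiv ℝ F (jetTrunc N p))
      (jetTrunc N p + (p.2 k - p.2 k) • jetDir N k) := by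
    simpa using (h.differentiable (jetTrunc N p)).hasFDerivAt
  simp only [h.eq, hpath]
  exact hF.comp_hasDerivAt (p.2 k) hd

theorem pdphi1_apply (h : JetRep f N F) (k : ℕ) (p : J1) :
    pdphi1 k f p = fderiv ℝ F (jetTrunc N p) (jetDir N k) :=
  (h.hasDerivAt_phi k p).deriv

theorem pdphi1_eq_zero (h : JetRep f N F) {k : ℕ} (hk : N ≤ k) : pdphi1 k f = 0 := by
  funext p
  simp [h.pdphi1_apply, jetDir_eq_zero hk]

theorem pdx1_apply (h : JetRep f N F) (p : J1) :
    pdx1 f p = fderiv ℝ F (jetTrunc N p) (1, 0) := by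
  have hd : HasDerivAt (fun t : ℝ => jetTrunc N (t, p.2)) (1, 0) p.1 :=
    (hasDerivAt_id p.1).prodMk (hasDerivAt_const p.1 fun i : Fin N => p.2 i)
  have hF : HasFDerivAt F (fderiv ℝ F (jetTrunc N p)) (jetTrunc N (p.1, p.2)) :=
    (h.differentiable (jetTrunc N p)).hasFDerivAt
  simp only [pdx1, h.eq]
  exact (hF.comp_hasDerivAt p.1 hd).deriv

theorem D1_apply (h : JetRep f N F) (p : J1) :
    D1 f p = fderiv ℝ F (jetTrunc N p) (1, fun i => p.2 (i + 1)) := by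
  have hv : ((1, fun i => p.2 (i + 1)) : ℝ × (Fin N → ℝ))
      = (1, 0) + ∑ k ∈ Finset.range N, p.2 (k + 1) • jetDir N k := by
    rw [sum_smul_jetDir N fun k => p.2 (k + 1)]
    simp
  rw [D1, h.pdx1_apply, tsum_eq_sum (s := Finset.range N), hv, map_add, map_sum]
  · simp [h.pdphi1_apply]
  · intro k hk
    simp [h.pdphi1_eq_zero (not_lt.1 (by simpa using hk))]

theorem smul (h : JetRep f N F) (c : ℝ) : JetRep (c • f) N (c • F) :=
  ⟨contDiff_const.smul h.contDiff, fun p => congrArg (c • ·) (h.eq p)⟩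

theorem add (hf : JetRep f N F) (hg : JetRep g N G) : JetRep (f + g) N (F + G) :=
  ⟨hf.contDiff.add hg.contDiff, fun p => congrArg₂ (· + ·) (hf.eq p) (hg.eq p)⟩

theorem mul (hf : JetRep f N F) (hg : JetRep g N G) : JetRep (f * g) N (F * G) :=
  ⟨hf.contDiff.mul hg.contDiff, fun p => congrArg₂ (· * ·) (hf.eq p) (hg.eq p)⟩

theorem pdphi1 (h : JetRep f N F) (k : ℕ) :
    JetRep (_root_.pdphi1 k f) N (fun y => fderiv ℝ F y (jetDir N k)) :=
  ⟨(h.contDiff.fderiv_right le_rfl).clm_apply contDiff_const, h.pdphi1_apply k⟩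

theorem D1 (h : JetRep f N F) :
    JetRep (_root_.D1 f) (N + 1)
      (fun y => fderiv ℝ F (y.1, fun i => y.2 i.castSucc) (1, fun i => y.2 i.succ)) := by
  refine ⟨?_, fun p => h.D1_apply p⟩
  exact ((h.contDiff.fderiv_right le_rfl).comp (by fun_prop)).clm_apply (by fun_prop)

/-- The commutator of `∂/∂φ_k` with the total derivative, on representatives. -/
theorem pdphi1_D1_apply (h : JetRep f N F) (k : ℕ) (p : J1) :
    _root_.pdphi1 k (_root_.D1 f) p = _root_.D1 (_root_.pdphi1 k f) p
      + fderiv ℝ F (jetTrunc N p) (0, fun i => if (i : ℕ) + 1 = k then 1 else 0) := by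
  have h2 : HasFDerivAt (fderiv ℝ F) (fderiv ℝ (fderiv ℝ F) (jetTrunc N p)) (jetTrunc N p) :=
    ((h.contDiff.fderiv_right (m := ∞) le_rfl).differentiable (by simp) _).hasFDerivAt
  let r : ℝ × (Fin (N + 1) → ℝ) →L[ℝ] ℝ × (Fin N → ℝ) :=
    (ContinuousLinearMap.fst ℝ _ _).prod (ContinuousLinearMap.pi fun i =>
      (ContinuousLinearMap.proj i.castSucc).comp (ContinuousLinearMap.snd ℝ _ _))
  let s : ℝ × (Fin (N + 1) → ℝ) →L[ℝ] ℝ × (Fin N → ℝ) :=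
    (0 : ℝ × (Fin (N + 1) → ℝ) →L[ℝ] ℝ).prod (ContinuousLinearMap.pi fun i =>
      (ContinuousLinearMap.proj i.succ).comp (ContinuousLinearMap.snd ℝ _ _))
  have hs : HasFDerivAt (fun y : ℝ × (Fin (N + 1) → ℝ) =>
      ((1, fun i => y.2 i.succ) : ℝ × (Fin N → ℝ))) s (jetTrunc (N + 1) p) := by
    have := s.hasFDerivAt (x := jetTrunc (N + 1) p) |>.const_add ((1, 0) : ℝ × (Fin N → ℝ))
    refine this.congr_of_eventuallyEq (Filter.Eventually.of_forall fun y => ?_)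
    ext i
    · simp [s]
    · simp [s]
  have hr : HasFDerivAt (fun y => fderiv ℝ F (r y))
      ((fderiv ℝ (fderiv ℝ F) (jetTrunc N p)).comp r) (jetTrunc (N + 1) p) :=
    HasFDerivAt.comp (jetTrunc (N + 1) p) (f := r) h2 r.hasFDerivAt
  have hsymm : IsSymmSndFDerivAt ℝ F (jetTrunc N p) :=
    h.contDiff.contDiffAt.isSymmSndFDerivAt (by
      rw [minSmoothness_of_isRCLikeNormedField]
      exact WithTop.coe_le_coe.2 (le_top : (2 : ℕ∞) ≤ ⊤))
  have hpd := (h2.clm_apply (hasFDerivAt_const (jetDir N k) (jetTrunc N p))).fderiv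
  rw [h.D1.pdphi1_apply, (h.pdphi1 k).D1_apply, hpd]
  have hD := (hr.clm_apply hs).fderiv
  have hrd : r (jetDir (N + 1) k) = jetDir N k := rfl
  have hsd : s (jetDir (N + 1) k) =
      (0, fun i : Fin N => if (i : ℕ) + 1 = k then (1 : ℝ) else 0) := by
    ext i
    · rfl
    · simp [s, jetDir]
  refine (congrArg (fun T => T (jetDir (N + 1) k)) hD).trans ?_
  simp only [add_apply, ContinuousLinearMap.comp_apply,
    ContinuousLinearMap.flip_apply, hrd, hsd, zero_apply, map_zero, zero_add]
  rw [add_comm, hsymm.eq]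
  rfl

end JetRep

namespace IsJetFun1

variable {f g : J1 → ℝ}

theorem exists_jetRep₂ (hf : IsJetFun1 f) (hg : IsJetFun1 g) :
    ∃ N F G, JetRep f N F ∧ JetRep g N G := by
  obtain ⟨N, F, hF⟩ := isJetFun1_iff_exists_jetRep.1 hf
  obtain ⟨M, G, hG⟩ := isJetFun1_iff_exists_jetRep.1 hg
  obtain ⟨F', hF'⟩ := hF.exists_of_le (le_max_left N M)
  obtain ⟨G', hG'⟩ := hG.exists_of_le (le_max_right N M)
  exact ⟨_, F', G', hF', hG'⟩

theorem smul (hf : IsJetFun1 f) (c : ℝ) : IsJetFun1 (c • f) := by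
  obtain ⟨N, F, hF⟩ := isJetFun1_iff_exists_jetRep.1 hf
  exact (hF.smul c).isJetFun1

theorem add (hf : IsJetFun1 f) (hg : IsJetFun1 g) : IsJetFun1 (f + g) := by
  obtain ⟨N, F, G, hF, hG⟩ := hf.exists_jetRep₂ hg
  exact (hF.add hG).isJetFun1

theorem mul (hf : IsJetFun1 f) (hg : IsJetFun1 g) : IsJetFun1 (f * g) := by
  obtain ⟨N, F, G, hF, hG⟩ := hf.exists_jetRep₂ hg
  exact (hF.mul hG).isJetFun1

theorem zero : IsJetFun1 0 := ⟨0, 0, contDiff_const, fun _ => rfl⟩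

theorem sum {ι : Type*} {s : Finset ι} {f : ι → J1 → ℝ} (hf : ∀ i ∈ s, IsJetFun1 (f i)) :
    IsJetFun1 (∑ i ∈ s, f i) :=
  Finset.sum_induction f IsJetFun1 (fun _ _ => add) zero hf

theorem pdphi1 (hf : IsJetFun1 f) (k : ℕ) : IsJetFun1 (pdphi1 k f) := by
  obtain ⟨N, F, hF⟩ := isJetFun1_iff_exists_jetRep.1 hf
  exact (hF.pdphi1 k).isJetFun1

theorem D1 (hf : IsJetFun1 f) : IsJetFun1 (D1 f) := by
  obtain ⟨N, F, hF⟩ := isJetFun1_iff_exists_jetRep.1 hf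
  exact hF.D1.isJetFun1

theorem D1_iterate (hf : IsJetFun1 f) (k : ℕ) : IsJetFun1 (_root_.D1^[k] f) := by
  induction k generalizing f with
  | zero => exact hf
  | succ k ih => exact ih hf.D1

end IsJetFun1

theorem jetRep_coord (k : ℕ) : JetRep (fun p => p.2 k) (k + 1) (fun y => y.2 (Fin.last k)) :=
  ⟨by fun_prop, fun p => by simp [jetTrunc]⟩

theorem D1_coord (k : ℕ) : D1 (fun p => p.2 k) = fun p => p.2 (k + 1) := by
  funext p
  rw [(jetRep_coord k).D1_apply]
  let T : ℝ × (Fin (k + 1) → ℝ) →L[ℝ] ℝ :=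
    (ContinuousLinearMap.proj (Fin.last k)).comp (ContinuousLinearMap.snd ℝ _ _)
  change fderiv ℝ T _ _ = _
  rw [T.fderiv]
  simp [T]

section Derivation

variable {f g : J1 → ℝ}

theorem D1_add (hf : IsJetFun1 f) (hg : IsJetFun1 g) : D1 (f + g) = D1 f + D1 g := by
  obtain ⟨N, F, G, hF, hG⟩ := hf.exists_jetRep₂ hg
  funext p
  rw [(hF.add hG).D1_apply, fderiv_add (hF.differentiable _) (hG.differentiable _)]
  simp [hF.D1_apply, hG.D1_apply]

theorem D1_smul (hf : IsJetFun1 f) (c : ℝ) : D1 (c • f) = c • D1 f := by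
  obtain ⟨N, F, hF⟩ := isJetFun1_iff_exists_jetRep.1 hf
  funext p
  rw [(hF.smul c).D1_apply, fderiv_const_smul (hF.differentiable _)]
  simp [hF.D1_apply]

theorem D1_mul (hf : IsJetFun1 f) (hg : IsJetFun1 g) : D1 (f * g) = f * D1 g + g * D1 f := by
  obtain ⟨N, F, G, hF, hG⟩ := hf.exists_jetRep₂ hg
  funext p
  rw [(hF.mul hG).D1_apply, fderiv_mul (hF.differentiable _) (hG.differentiable _)]
  simp [hF.D1_apply, hG.D1_apply, hF.eq, hG.eq]

theorem D1_zero : D1 0 = 0 := by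
  simpa using D1_smul IsJetFun1.zero 0

theorem D1_iterate_zero (k : ℕ) : D1^[k] 0 = 0 :=
  Function.iterate_fixed D1_zero k

theorem D1_sum {ι : Type*} (s : Finset ι) {f : ι → J1 → ℝ} (hf : ∀ i ∈ s, IsJetFun1 (f i)) :
    D1 (∑ i ∈ s, f i) = ∑ i ∈ s, D1 (f i) := by
  classical
  induction s using Finset.induction_on with
  | empty => exact D1_zero
  | insert i s hi ih =>
    have hs : ∀ j ∈ s, IsJetFun1 (f j) := fun j hj => hf j (Finset.mem_insert_of_mem hj)
    rw [Finset.sum_insert hi, Finset.sum_insert hi,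
      D1_add (hf i (Finset.mem_insert_self i s)) (IsJetFun1.sum hs), ih hs]

theorem D1_iterate_add (hf : IsJetFun1 f) (hg : IsJetFun1 g) (k : ℕ) :
    D1^[k] (f + g) = D1^[k] f + D1^[k] g := by
  induction k generalizing f g with
  | zero => rfl
  | succ k ih => simp only [Function.iterate_succ_apply, D1_add hf hg, ih hf.D1 hg.D1]

theorem pdphi1_zero_D1 (hf : IsJetFun1 f) : pdphi1 0 (D1 f) = D1 (pdphi1 0 f) := by
  obtain ⟨N, F, hF⟩ := isJetFun1_iff_exists_jetRep.1 hf
  funext p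
  have : ((0, fun _ => 0) : ℝ × (Fin N → ℝ)) = 0 := rfl
  simp [hF.pdphi1_D1_apply, this]

theorem pdphi1_succ_D1 (hf : IsJetFun1 f) (k : ℕ) :
    pdphi1 (k + 1) (D1 f) = D1 (pdphi1 (k + 1) f) + pdphi1 k f := by
  obtain ⟨N, F, hF⟩ := isJetFun1_iff_exists_jetRep.1 hf
  funext p
  simp [hF.pdphi1_D1_apply, hF.pdphi1_apply k, jetDir]

end Derivation

theorem JetRep.euler1_apply {f : J1 → ℝ} {N : ℕ} {F : ℝ × (Fin N → ℝ) → ℝ} (h : JetRep f N F)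
    (p : J1) :
    euler1 f p = ∑ k ∈ Finset.range N, (-1 : ℝ) ^ k * (_root_.D1^[k] (_root_.pdphi1 k f)) p := by
  refine tsum_eq_sum fun k hk => ?_
  rw [h.pdphi1_eq_zero (not_lt.1 (by simpa using hk)), D1_iterate_zero]
  simp

/-- The partial sums of the Euler operator applied to a total derivative telescope. -/
theorem sum_euler1_D1 {f : J1 → ℝ} (hf : IsJetFun1 f) (M : ℕ) (p : J1) :
    ∑ k ∈ Finset.range (M + 1), (-1 : ℝ) ^ k * (D1^[k] (pdphi1 k (D1 f))) p
      = (-1) ^ M * (D1^[M + 1] (pdphi1 M f)) p := by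
  induction M with
  | zero => simp [pdphi1_zero_D1 hf]
  | succ M ih =>
    rw [Finset.sum_range_succ, ih, pdphi1_succ_D1 hf,
      D1_iterate_add (hf.pdphi1 (M + 1)).D1 (hf.pdphi1 M), ← Function.iterate_succ_apply D1]
    simp only [Pi.add_apply]
    ring

theorem euler1_D1 {f : J1 → ℝ} (hf : IsJetFun1 f) (p : J1) : euler1 (D1 f) p = 0 := by
  obtain ⟨N, F, hF⟩ := isJetFun1_iff_exists_jetRep.1 hf
  rw [hF.D1.euler1_apply, sum_euler1_D1 hf, hF.pdphi1_eq_zero le_rfl, D1_iterate_zero]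
  simp

/-- Integration by parts: `φ_k g` and `(-1)^k φ_0 D^k g` differ by a total derivative. -/
theorem exists_coord_mul_eq_add_D1 (k : ℕ) {g : J1 → ℝ} (hg : IsJetFun1 g) :
    ∃ Q, IsJetFun1 Q ∧ ∀ p : J1, p.2 k * g p = (-1) ^ k * (p.2 0 * (D1^[k] g) p) + D1 Q p := by
  induction k generalizing g with
  | zero => exact ⟨0, IsJetFun1.zero, fun p => by simp [D1_zero]⟩
  | succ k ih =>
    obtain ⟨Q, hQ, h⟩ := ih hg.D1
    have hk := (jetRep_coord k).isJetFun1
    refine ⟨(fun p => p.2 k) * g + (-1 : ℝ) • Q, (hk.mul hg).add (hQ.smul _), fun p => ?_⟩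
    rw [D1_add (hk.mul hg) (hQ.smul _), D1_mul hk hg, D1_smul hQ, D1_coord]
    simp only [Pi.add_apply, Pi.mul_apply, Pi.smul_apply, smul_eq_mul, h p,
      Function.iterate_succ_apply]
    ring

/-- The average of `f` over the segment from the zero jet, `∫₀¹ f(x, sφ) ds`. -/
noncomputable def fiberAverage (f : J1 → ℝ) (p : J1) : ℝ :=
  ∫ s in (0 : ℝ)..1, f (p.1, s • p.2)

/-- The fibrewise dilation `(x, φ) ↦ (x, sφ)` of the truncated jet space. -/
def jetDilation (N : ℕ) (s : ℝ) : ℝ × (Fin N → ℝ) →L[ℝ] ℝ × (Fin N → ℝ) :=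
  (ContinuousLinearMap.fst ℝ _ _).prod (s • ContinuousLinearMap.snd ℝ _ _)

namespace JetRep

variable {f : J1 → ℝ} {N : ℕ} {F : ℝ × (Fin N → ℝ) → ℝ}

theorem contDiff_dilation (h : JetRep f N F) :
    ContDiff ℝ ∞ fun q : (ℝ × (Fin N → ℝ)) × ℝ => F (jetDilation N q.2 q.1) :=
  h.contDiff.comp (by simp only [jetDilation, ContinuousLinearMap.prod_apply]; fun_prop)

theorem fiberAverage (h : JetRep f N F) :
    JetRep (fiberAverage f) N (fun y => ∫ s in (0 : ℝ)..1, F (jetDilation N s y)) :=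
  ⟨contDiff_intervalIntegral h.contDiff_dilation 0 1, fun p => by
    simp only [_root_.fiberAverage, h.eq]
    rfl⟩

theorem continuous_dilation (h : JetRep f N F) (p : J1) :
    Continuous fun s : ℝ => f (p.1, s • p.2) := by
  simp only [h.eq]
  exact h.contDiff_dilation.continuous.comp (Continuous.prodMk_right (jetTrunc N p))

theorem D1_fiberAverage (h : JetRep f N F) :
    _root_.D1 (_root_.fiberAverage f) = _root_.fiberAverage (_root_.D1 f) := by
  funext p
  have hc : ContDiff ℝ 1 fun q : (ℝ × (Fin N → ℝ)) × ℝ => F (jetDilation N q.2 q.1) :=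
    h.contDiff_dilation.of_le (by exact_mod_cast le_top)
  have hint : Continuous fun s : ℝ =>
      (fderiv ℝ (fun q : (ℝ × (Fin N → ℝ)) × ℝ => F (jetDilation N q.2 q.1))
        (jetTrunc N p, s)).comp (ContinuousLinearMap.inl ℝ (ℝ × (Fin N → ℝ)) ℝ) :=
    ((hc.continuous_fderiv one_ne_zero).comp (Continuous.prodMk_right _)).clm_comp
      continuous_const
  rw [h.fiberAverage.D1_apply,
    (hasFDerivAt_intervalIntegral_of_contDiff hc 0 1 (jetTrunc N p)).fderiv,
    ContinuousLinearMap.intervalIntegral_apply (hint.intervalIntegrable _ _)]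
  refine intervalIntegral.integral_congr fun s _ => ?_
  have h1 := HasFDerivAt.comp (jetTrunc N p) (f := fun y => (y, s))
    ((hc.differentiable one_ne_zero) (jetTrunc N p, s)).hasFDerivAt
    (hasFDerivAt_prodMk_left (jetTrunc N p) s)
  have h2 : HasFDerivAt (fun y => F (jetDilation N s y))
      ((fderiv ℝ F (jetDilation N s (jetTrunc N p))).comp (jetDilation N s)) (jetTrunc N p) :=
    HasFDerivAt.comp (jetTrunc N p) (h.differentiable _).hasFDerivAt
      (jetDilation N s).hasFDerivAt
  simp only [h1.unique h2, h.D1_apply]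
  rfl

/-- The fundamental theorem of calculus along the segment from the zero jet. -/
theorem eq_add_sum_coord_mul_fiberAverage (h : JetRep f N F) (p : J1) :
    f p = f (p.1, 0) +
      ∑ k ∈ Finset.range N, p.2 k * _root_.fiberAverage (_root_.pdphi1 k f) p := by
  have hv : ((0, fun i => p.2 i) : ℝ × (Fin N → ℝ))
      = ∑ k ∈ Finset.range N, p.2 k • jetDir N k := (sum_smul_jetDir N p.2).symm
  have hd : ∀ s ∈ Set.uIcc (0 : ℝ) 1, HasDerivAt (fun s : ℝ => f (p.1, s • p.2))
      (∑ k ∈ Finset.range N, p.2 k * _root_.pdphi1 k f (p.1, s • p.2)) s := by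
    intro s _
    have hp : HasDerivAt (fun s : ℝ => jetTrunc N (p.1, s • p.2)) (0, fun i => p.2 i) s := by
      have h1 : HasDerivAt (fun s : ℝ => s • fun i : Fin N => p.2 i) (fun i : Fin N => p.2 i) s := by
        simpa using (hasDerivAt_id s).smul_const fun i : Fin N => p.2 i
      exact (hasDerivAt_const s p.1).prodMk h1
    have h2 := (h.differentiable (jetTrunc N (p.1, s • p.2))).hasFDerivAt.comp_hasDerivAt s hp
    simp only [hv, map_sum, map_smul, smul_eq_mul] at h2
    simp only [h.eq, h.pdphi1_apply]
    exact h2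
  have hi : ∀ k ∈ Finset.range N, Continuous fun s : ℝ =>
      p.2 k * _root_.pdphi1 k f (p.1, s • p.2) := fun k _ =>
    continuous_const.mul ((h.pdphi1 k).continuous_dilation p)
  have hftc := intervalIntegral.integral_eq_sub_of_hasDerivAt hd
    ((continuous_finsetSum _ hi).intervalIntegrable _ _)
  rw [intervalIntegral.integral_finsetSum fun k hk => (hi k hk).intervalIntegrable _ _] at hftc
  simp only [intervalIntegral.integral_const_mul, one_smul, zero_smul] at hftc
  exact (sub_eq_iff_eq_add'.1 hftc.symm)

end JetRep

theorem D1_iterate_fiberAverage {f : J1 → ℝ} (hf : IsJetFun1 f) (k : ℕ) :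
    D1^[k] (fiberAverage f) = fiberAverage (D1^[k] f) := by
  induction k generalizing f with
  | zero => rfl
  | succ k ih =>
    obtain ⟨N, F, hF⟩ := isJetFun1_iff_exists_jetRep.1 hf
    rw [Function.iterate_succ_apply, Function.iterate_succ_apply, hF.D1_fiberAverage, ih hf.D1]

/-- A smooth function of `x` alone is a total derivative. -/
theorem exists_D1_eq_of_contDiff {u : ℝ → ℝ} (hu : ContDiff ℝ ∞ u) :
    ∃ Q, IsJetFun1 Q ∧ ∀ p : J1, D1 Q p = u p.1 := by
  have hd : ∀ x, HasDerivAt (fun x => ∫ t in (0 : ℝ)..x, u t) (u x) x := fun x =>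
    (hu.continuous.integral_hasStrictDerivAt 0 x).hasDerivAt
  have hU : ContDiff ℝ ∞ fun x => ∫ t in (0 : ℝ)..x, u t := by
    refine contDiff_infty_iff_deriv.2 ⟨fun x => (hd x).differentiableAt, ?_⟩
    rwa [funext fun x => (hd x).deriv]
  have hQ : JetRep (fun p => ∫ t in (0 : ℝ)..p.1, u t) 0 (fun y => ∫ t in (0 : ℝ)..y.1, u t) :=
    ⟨hU.comp contDiff_fst, fun p => rfl⟩
  refine ⟨_, hQ.isJetFun1, fun p => ?_⟩
  rw [D1]
  simp only [hQ.pdphi1_eq_zero (Nat.zero_le _)]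
  simpa [pdx1] using (hd p.1).deriv

/-- for `m = n = 1`, a jet function `L` satisfies `E(L) = 0`
identically iff `L` is a total derivative `L = D F`. -/
theorem euler1_eq_zero_iff_total_derivative (L : J1 → ℝ) (hL : IsJetFun1 L) :
    (∀ p, euler1 L p = 0) ↔
      ∃ F : J1 → ℝ, IsJetFun1 F ∧ ∀ p, L p = D1 F p := by
  constructor
  · intro hE
    obtain ⟨N, F, hF⟩ := isJetFun1_iff_exists_jetRep.1 hL
    have hzero : ContDiff ℝ ∞ fun x : ℝ => L (x, 0) := by
      simp only [hF.eq]
      exact hF.contDiff.comp (contDiff_id.prodMk (contDiff_const (c := fun _ => 0)))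
    obtain ⟨Q₀, hQ₀, hQ₀D⟩ := exists_D1_eq_of_contDiff hzero
    choose Q hQ hQD using fun k =>
      exists_coord_mul_eq_add_D1 k (hF.pdphi1 k).fiberAverage.isJetFun1
    have hS : IsJetFun1 (∑ k ∈ Finset.range N, Q k) := IsJetFun1.sum fun k _ => hQ k
    refine ⟨Q₀ + ∑ k ∈ Finset.range N, Q k, hQ₀.add hS, fun p => ?_⟩
    have hEavg : ∑ k ∈ Finset.range N,
        (-1 : ℝ) ^ k * (D1^[k] (fiberAverage (pdphi1 k L))) p = 0 := by
      have hi : ∀ k ∈ Finset.range N, IntervalIntegrable (fun s : ℝ =>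
          (-1 : ℝ) ^ k * (D1^[k] (pdphi1 k L)) (p.1, s • p.2)) MeasureTheory.volume 0 1 := by
        intro k _
        obtain ⟨M, G, hG⟩ := isJetFun1_iff_exists_jetRep.1 ((hL.pdphi1 k).D1_iterate k)
        exact (continuous_const.mul (hG.continuous_dilation p)).intervalIntegrable _ _
      simp only [D1_iterate_fiberAverage (hL.pdphi1 _), fiberAverage,
        ← intervalIntegral.integral_const_mul]
      rw [← intervalIntegral.integral_finsetSum hi]
      simp only [← hF.euler1_apply, hE, intervalIntegral.integral_zero]
    have hsum : ∑ k ∈ Finset.range N, (-1 : ℝ) ^ k *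
        (p.2 0 * (D1^[k] (fiberAverage (pdphi1 k L))) p) = 0 := by
      simp only [mul_left_comm _ (p.2 0)]
      rw [← Finset.mul_sum, hEavg, mul_zero]
    rw [hF.eq_add_sum_coord_mul_fiberAverage p, D1_add hQ₀ hS, D1_sum _ fun k _ => hQ k,
      Finset.sum_congr rfl fun k _ => hQD k p, Finset.sum_add_distrib, hsum, zero_add]
    simp [hQ₀D]
  · rintro ⟨F, hF, hLF⟩ p
    rw [funext hLF, euler1_D1 hF]
end

section
/- The variational differential on Lagrangians of multidimensional paths squares to zero: for any r-Lagrangian L (a finite-order smooth function of the jet coordinates x^a_σ, σ a multi-index in {1,…,r}, of a map R^r → R^m), the (r+2)-Lagrangian d̄(d̄ L) vanishes identically, where d̄L := Σ_a x^a_{r+1} F_a(L) with F_a(L) = Σ_σ (−1)^{|σ|} D_σ(∂L/∂x^a_σ) and D_i = Σ x^a_{iσ} ∂/∂x^a_σ the total derivative in the i-th parameter. -/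
open scoped BigOperators

/-- Multi-indices in the `r` parameters `t^1, …, t^r`, as exponent vectors. -/
abbrev PIdx (r : ℕ) := Fin r → ℕ

/-- The space of infinite jets (tangent elements) at a point of maps
`ℝ^r → ℝ^m`: the coordinates are `x^a_σ` (`x^a = x^a_∅` included). -/
abbrev PJet (r m : ℕ) := (Fin m × PIdx r) → ℝ

variable {r m : ℕ}

/-- Partial derivative with respect to the jet coordinate `x^a_σ`. -/
noncomputable def ppd (c : Fin m × PIdx r) (f : PJet r m → ℝ) (p : PJet r m) : ℝ :=
  deriv (fun t => f (Function.update p c t)) (p c)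

/-- The total derivative `D_i = Σ_{a,σ} x^a_{iσ} ∂/∂x^a_σ` in the `i`-th parameter. -/
noncomputable def ptotalD (i : Fin r) (f : PJet r m → ℝ) (p : PJet r m) : ℝ :=
  ∑' c : Fin m × PIdx r, p (c.1, c.2 + Pi.single i 1) * ppd c f p

/-- The iterated total derivative `D_σ`. -/
noncomputable def pDmulti (σ : PIdx r) (f : PJet r m → ℝ) : PJet r m → ℝ :=
  (List.finRange r).foldr (fun i g => (ptotalD i)^[σ i] g) f

/-- Total degree of a multi-index. -/
def pdeg (σ : PIdx r) : ℕ := ∑ i, σ i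

/-- An `r`-Lagrangian: a smooth function of finitely many jet coordinates. -/
def IsPJetFun (f : PJet r m → ℝ) : Prop :=
  ∃ (N : ℕ) (c : Fin N → Fin m × PIdx r) (F : (Fin N → ℝ) → ℝ),
    ContDiff ℝ (⊤ : ℕ∞) F ∧ ∀ p, f p = F (fun i => p (c i))

/-- The variational derivative `F_a(L) = Σ_σ (−1)^{|σ|} D_σ (∂L/∂x^a_σ)`. -/
noncomputable def varder (a : Fin m) (L : PJet r m → ℝ) (p : PJet r m) : ℝ :=
  ∑' σ : PIdx r, (-1 : ℝ) ^ pdeg σ * pDmulti σ (ppd (a, σ) L) p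

/-- Lift an `r`-Lagrangian to a function of jets in `r+1` parameters
(a multi-index `σ` in `t^1, …, t^r` becomes `Fin.snoc σ 0`). -/
def plift (L : PJet r m → ℝ) : PJet (r + 1) m → ℝ :=
  fun p => L (fun c => p (c.1, Fin.snoc c.2 0))

/-- The variational differential `d̄L = Σ_a x^a_{r+1} F_a(L)`,
an `(r+1)`-Lagrangian. -/
noncomputable def dbar (L : PJet r m → ℝ) : PJet (r + 1) m → ℝ :=
  fun p => ∑ a : Fin m,
    p (a, Pi.single (Fin.last r) 1) * plift (fun q => varder a L q) p

namespace IsPJetFun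

theorem of_fintype {ι : Type*} [Fintype ι] (c : ι → Fin m × PIdx r) {F : (ι → ℝ) → ℝ}
    (hF : ContDiff ℝ (⊤ : ℕ∞) F) : IsPJetFun (fun p : PJet r m => F fun i => p (c i)) := by
  refine ⟨Fintype.card ι, c ∘ (Fintype.equivFin ι).symm,
    fun x => F fun i => x (Fintype.equivFin ι i), ?_, fun p => by simp⟩
  fun_prop

theorem comp₂ {f g : PJet r m → ℝ} (hf : IsPJetFun f) (hg : IsPJetFun g) {G : ℝ → ℝ → ℝ}
    (hG : ContDiff ℝ (⊤ : ℕ∞) (fun x : ℝ × ℝ => G x.1 x.2)) :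
    IsPJetFun (fun p => G (f p) (g p)) := by
  obtain ⟨M, c, F, hF, hf⟩ := hf
  obtain ⟨N, d, H, hH, hg⟩ := hg
  have h : ContDiff ℝ (⊤ : ℕ∞) (fun x : Fin M ⊕ Fin N → ℝ =>
      G (F fun i => x (Sum.inl i)) (H fun i => x (Sum.inr i))) :=
    hG.comp ((hF.comp (by fun_prop)).prodMk (hH.comp (by fun_prop)))
  simpa [hf, hg] using of_fintype (Sum.elim c d) h

theorem const (a : ℝ) : IsPJetFun (fun _ : PJet r m => a) :=
  of_fintype (ι := Empty) Empty.elim contDiff_const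

theorem coord (c : Fin m × PIdx r) : IsPJetFun (fun p : PJet r m => p c) :=
  of_fintype (ι := Unit) (fun _ => c) (F := fun x => x ()) (by fun_prop)

theorem plift {f : PJet r m → ℝ} (hf : IsPJetFun f) : IsPJetFun (plift f) := by
  obtain ⟨N, c, F, hF, hf⟩ := hf
  exact ⟨N, fun i => ((c i).1, Fin.snoc (c i).2 0), F, hF, fun p => hf _⟩

end IsPJetFun

theorem hasDerivAt_comp_update {N : ℕ} (c : Fin N → Fin m × PIdx r) {F : (Fin N → ℝ) → ℝ}
    (hF : ContDiff ℝ (⊤ : ℕ∞) F) (d : Fin m × PIdx r) (p : PJet r m) :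
    HasDerivAt (fun t => F fun i => Function.update p d t (c i))
      (fderiv ℝ F (fun i => p (c i)) fun i => if c i = d then 1 else 0) (p d) := by
  have h : HasDerivAt (fun t i => Function.update p d t (c i))
      (fun i => if c i = d then (1 : ℝ) else 0) (p d) := by
    rw [hasDerivAt_pi]
    intro i
    by_cases hi : c i = d
    · simpa [hi] using hasDerivAt_id' (p d)
    · simpa [hi] using hasDerivAt_const (p d) (p (c i))
  have hF' := (hF.differentiable (by simp) (fun i => Function.update p d (p d) (c i))).hasFDerivAt
  simpa [Function.comp_def] using hF'.comp_hasDerivAt (p d) h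

theorem ppd_eq_fderiv {f : PJet r m → ℝ} {N : ℕ} {c : Fin N → Fin m × PIdx r}
    {F : (Fin N → ℝ) → ℝ} (hF : ContDiff ℝ (⊤ : ℕ∞) F) (hf : ∀ p, f p = F fun i => p (c i))
    (d : Fin m × PIdx r) (p : PJet r m) :
    ppd d f p = fderiv ℝ F (fun i => p (c i)) fun i => if c i = d then 1 else 0 := by
  simpa only [ppd, hf] using (hasDerivAt_comp_update c hF d p).deriv

theorem contDiff_fderiv_apply {N : ℕ} {F : (Fin N → ℝ) → ℝ} (hF : ContDiff ℝ (⊤ : ℕ∞) F)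
    (v : Fin N → ℝ) : ContDiff ℝ (⊤ : ℕ∞) (fun x => fderiv ℝ F x v) :=
  (hF.fderiv_right (by simp)).clm_apply contDiff_const

namespace IsPJetFun

theorem differentiableAt_update {f : PJet r m → ℝ} (hf : IsPJetFun f) (d : Fin m × PIdx r)
    (p : PJet r m) : DifferentiableAt ℝ (fun t => f (Function.update p d t)) (p d) := by
  obtain ⟨N, c, F, hF, hf⟩ := hf
  simpa only [hf] using (hasDerivAt_comp_update c hF d p).differentiableAt

theorem ppd {f : PJet r m → ℝ} (hf : IsPJetFun f) (d : Fin m × PIdx r) :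
    IsPJetFun (ppd d f) := by
  obtain ⟨N, c, F, hF, hf⟩ := hf
  exact ⟨N, c, _, contDiff_fderiv_apply hF _, ppd_eq_fderiv hF hf d⟩

theorem ppd_comm {f : PJet r m → ℝ} (hf : IsPJetFun f) (d e : Fin m × PIdx r) :
    _root_.ppd d (_root_.ppd e f) = _root_.ppd e (_root_.ppd d f) := by
  obtain ⟨N, c, F, hF, hf⟩ := hf
  funext p
  rw [ppd_eq_fderiv (contDiff_fderiv_apply hF _) (ppd_eq_fderiv hF hf e),
    ppd_eq_fderiv (contDiff_fderiv_apply hF _) (ppd_eq_fderiv hF hf d)]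
  have hd : DifferentiableAt ℝ (fderiv ℝ F) fun i => p (c i) :=
    (hF.fderiv_right (m := 1) (by norm_cast)).differentiable (by simp) _
  rw [fderiv_clm_apply hd (differentiableAt_const _), fderiv_clm_apply hd (differentiableAt_const _)]
  have h2 : (2 : WithTop ℕ∞) ≤ (⊤ : ℕ∞) := WithTop.coe_le_coe.mpr (le_top : (2 : ℕ∞) ≤ ⊤)
  simpa using (hF.contDiffAt.isSymmSndFDerivAt (by simpa using h2)) _ _

theorem exists_ppd_eq_zero {f : PJet r m → ℝ} (hf : IsPJetFun f) :
    ∃ S : Finset (Fin m × PIdx r), ∀ c ∉ S, _root_.ppd c f = 0 := by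
  obtain ⟨N, c, F, hF, hf⟩ := hf
  refine ⟨Finset.univ.image c, fun d hd => ?_⟩
  funext p
  rw [ppd_eq_fderiv hF hf]
  have : (fun i => if c i = d then (1 : ℝ) else 0) = 0 := by
    funext i
    exact if_neg fun h => hd (by simp [← h])
  simp [this]

end IsPJetFun

theorem ppd_coord (c d : Fin m × PIdx r) (p : PJet r m) :
    ppd c (fun q => q d) p = if d = c then 1 else 0 := by
  by_cases h : d = c
  · subst h; simp [ppd]
  · simp [ppd, h]

theorem ptotalD_eq_sum {f : PJet r m → ℝ} {S : Finset (Fin m × PIdx r)}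
    (hS : ∀ c ∉ S, ppd c f = 0) (i : Fin r) (p : PJet r m) :
    ptotalD i f p = ∑ c ∈ S, p (c.1, c.2 + Pi.single i 1) * ppd c f p :=
  tsum_eq_sum fun c hc => by simp [hS c hc]

variable (r m) in
/-- The algebra of smooth functions of finitely many jet coordinates. -/
def jetAlgebra : Subalgebra ℝ (PJet r m → ℝ) where
  carrier := {f | IsPJetFun f}
  mul_mem' hf hg := IsPJetFun.comp₂ hf hg (G := fun x y => x * y) (by fun_prop)
  add_mem' hf hg := IsPJetFun.comp₂ hf hg (G := fun x y => x + y) (by fun_prop)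
  algebraMap_mem' a := IsPJetFun.const a

/-- The coordinate function `x^a_σ`. -/
def jetCoord (c : Fin m × PIdx r) : jetAlgebra r m := ⟨fun p => p c, IsPJetFun.coord c⟩

/-- The partial derivative as a derivation of the algebra of jet functions. -/
noncomputable def jetPartial (c : Fin m × PIdx r) :
    Derivation ℝ (jetAlgebra r m) (jetAlgebra r m) :=
  Derivation.mk'
    { toFun := fun f => ⟨ppd c f.1, IsPJetFun.ppd f.2 c⟩
      map_add' := fun f g => Subtype.ext <| funext fun p =>
        deriv_fun_add (IsPJetFun.differentiableAt_update f.2 c p)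
          (IsPJetFun.differentiableAt_update g.2 c p)
      map_smul' := fun a f => Subtype.ext <| funext fun p =>
        deriv_const_mul a (IsPJetFun.differentiableAt_update f.2 c p) }
    fun f g => Subtype.ext <| funext fun p => by
      have h := deriv_fun_mul (IsPJetFun.differentiableAt_update f.2 c p)
          (IsPJetFun.differentiableAt_update g.2 c p)
      simp only [Function.update_eq_self] at h
      exact h.trans (by simp [ppd]; ring)

@[simp]
theorem coe_jetPartial (c : Fin m × PIdx r) (f : jetAlgebra r m) :
    (jetPartial c f : PJet r m → ℝ) = ppd c f := rfl

theorem jetPartial_comm (c d : Fin m × PIdx r) (f : jetAlgebra r m) :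
    jetPartial c (jetPartial d f) = jetPartial d (jetPartial c f) :=
  Subtype.ext (IsPJetFun.ppd_comm f.2 c d)

theorem jetPartial_coord (c d : Fin m × PIdx r) :
    jetPartial c (jetCoord d) = if d = c then 1 else 0 := by
  refine Subtype.ext (funext fun p => (ppd_coord c d p).trans ?_)
  split_ifs <;> rfl

theorem exists_jetPartial_eq_zero (f : jetAlgebra r m) :
    ∃ S : Finset (Fin m × PIdx r), ∀ c ∉ S, jetPartial c f = 0 := by
  obtain ⟨S, hS⟩ := IsPJetFun.exists_ppd_eq_zero f.2
  exact ⟨S, fun c hc => Subtype.ext (hS c hc)⟩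

theorem ptotalD_eq_coe_sum {f : jetAlgebra r m} {S : Finset (Fin m × PIdx r)}
    (hS : ∀ c ∉ S, jetPartial c f = 0) (i : Fin r) :
    ptotalD i f.1 =
      (∑ c ∈ S, jetCoord (c.1, c.2 + Pi.single i 1) * jetPartial c f : jetAlgebra r m).1 := by
  funext p
  rw [ptotalD_eq_sum (fun c hc => congrArg Subtype.val (hS c hc))]
  simp [jetCoord]

/-- The total derivative as a linear endomorphism of the algebra of jet functions. -/
noncomputable def jetTotal (i : Fin r) : Module.End ℝ (jetAlgebra r m) where
  toFun f := ⟨ptotalD i f.1, by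
    obtain ⟨S, hS⟩ := exists_jetPartial_eq_zero f
    rw [ptotalD_eq_coe_sum hS]
    exact Subtype.property _⟩
  map_add' f g := Subtype.ext <| by
    obtain ⟨S, hS⟩ := exists_jetPartial_eq_zero f
    obtain ⟨T, hT⟩ := exists_jetPartial_eq_zero g
    have hf : ∀ c ∉ S ∪ T, jetPartial c f = 0 := fun c hc => hS c (by simp_all)
    have hg : ∀ c ∉ S ∪ T, jetPartial c g = 0 := fun c hc => hT c (by simp_all)
    have hfg : ∀ c ∉ S ∪ T, jetPartial c (f + g) = 0 := fun c hc => by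
      rw [map_add, hf c hc, hg c hc, add_zero]
    change ptotalD i _ = ptotalD i _ + ptotalD i _
    rw [ptotalD_eq_coe_sum hf, ptotalD_eq_coe_sum hg, ptotalD_eq_coe_sum hfg]
    rw [← Subalgebra.coe_add, ← Finset.sum_add_distrib]
    simp only [map_add, mul_add]
  map_smul' a f := Subtype.ext <| by
    obtain ⟨S, hS⟩ := exists_jetPartial_eq_zero f
    have haf : ∀ c ∉ S, jetPartial c (a • f) = 0 := fun c hc => by
      rw [Derivation.map_smul, hS c hc, smul_zero]
    change ptotalD i _ = a • ptotalD i _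
    rw [ptotalD_eq_coe_sum hS, ptotalD_eq_coe_sum haf, ← Subalgebra.coe_smul, Finset.smul_sum]
    simp only [Derivation.map_smul, mul_smul_comm]

theorem jetTotal_eq_sum {f : jetAlgebra r m} {S : Finset (Fin m × PIdx r)}
    (hS : ∀ c ∉ S, jetPartial c f = 0) (i : Fin r) :
    jetTotal i f = ∑ c ∈ S, jetCoord (c.1, c.2 + Pi.single i 1) * jetPartial c f :=
  Subtype.ext (ptotalD_eq_coe_sum hS i)

theorem jetTotal_mul (i : Fin r) (f g : jetAlgebra r m) :
    jetTotal i (f * g) = f * jetTotal i g + jetTotal i f * g := by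
  obtain ⟨S, hS⟩ := exists_jetPartial_eq_zero f
  obtain ⟨T, hT⟩ := exists_jetPartial_eq_zero g
  have hf : ∀ c ∉ S ∪ T, jetPartial c f = 0 := fun c hc => hS c (by simp_all)
  have hg : ∀ c ∉ S ∪ T, jetPartial c g = 0 := fun c hc => hT c (by simp_all)
  have hfg : ∀ c ∉ S ∪ T, jetPartial c (f * g) = 0 := fun c hc => by
    rw [Derivation.leibniz, hf c hc, hg c hc]; simp
  rw [jetTotal_eq_sum hf, jetTotal_eq_sum hg, jetTotal_eq_sum hfg, Finset.mul_sum,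
    Finset.sum_mul, ← Finset.sum_add_distrib]
  refine Finset.sum_congr rfl fun c _ => ?_
  rw [Derivation.leibniz, smul_eq_mul, smul_eq_mul]
  ring

theorem jetTotal_coord (i : Fin r) (c : Fin m × PIdx r) :
    jetTotal i (jetCoord c) = jetCoord (c.1, c.2 + Pi.single i 1) := by
  have hS : ∀ d ∉ ({c} : Finset (Fin m × PIdx r)), jetPartial d (jetCoord c) = 0 :=
    fun d hd => by rw [jetPartial_coord, if_neg]; rintro rfl; simp at hd
  rw [jetTotal_eq_sum hS, Finset.sum_singleton, jetPartial_coord, if_pos rfl, mul_one]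

theorem jetPartial_jetPartial_eq_zero {f : jetAlgebra r m} {S : Finset (Fin m × PIdx r)}
    (hS : ∀ c ∉ S, jetPartial c f = 0) (d : Fin m × PIdx r) :
    ∀ c ∉ S, jetPartial c (jetPartial d f) = 0 := fun c hc => by
  rw [jetPartial_comm, hS c hc, map_zero]

theorem jetTotal_comm (i j : Fin r) (f : jetAlgebra r m) :
    jetTotal i (jetTotal j f) = jetTotal j (jetTotal i f) := by
  obtain ⟨S, hS⟩ := exists_jetPartial_eq_zero f
  have key : ∀ i j : Fin r, jetTotal i (jetTotal j f) =
      ∑ c ∈ S, ∑ d ∈ S, jetCoord (c.1, c.2 + Pi.single j 1) *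
        (jetCoord (d.1, d.2 + Pi.single i 1) * jetPartial d (jetPartial c f)) +
      ∑ c ∈ S, jetCoord (c.1, c.2 + Pi.single j 1 + Pi.single i 1) * jetPartial c f := by
    intro i j
    rw [jetTotal_eq_sum hS j, map_sum, ← Finset.sum_add_distrib]
    refine Finset.sum_congr rfl fun c _ => ?_
    rw [jetTotal_mul, jetTotal_coord, jetTotal_eq_sum (jetPartial_jetPartial_eq_zero hS c),
      Finset.mul_sum]
  rw [key, key, Finset.sum_comm]
  congr 1
  · refine Finset.sum_congr rfl fun c _ => Finset.sum_congr rfl fun d _ => ?_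
    rw [jetPartial_comm c d]
    ring
  · simp only [add_right_comm]

theorem PIdx.sub_single_add_single {σ : PIdx r} {i : Fin r} (h : σ i ≠ 0) :
    σ - Pi.single i 1 + Pi.single i 1 = σ := by
  funext j
  by_cases hj : j = i
  · subst hj
    simp only [Pi.add_apply, Pi.sub_apply, Pi.single_eq_same]
    omega
  · simp [hj]

theorem jetPartial_jetTotal (c : Fin m × PIdx r) (i : Fin r) (f : jetAlgebra r m) :
    jetPartial c (jetTotal i f) = jetTotal i (jetPartial c f) +
      if c.2 i = 0 then 0 else jetPartial (c.1, c.2 - Pi.single i 1) f := by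
  obtain ⟨S, hS⟩ := exists_jetPartial_eq_zero f
  have hc : (∑ d ∈ S, jetPartial d f * if (d.1, d.2 + Pi.single i 1) = c then 1 else 0) =
      if c.2 i = 0 then 0 else jetPartial (c.1, c.2 - Pi.single i 1) f := by
    split_ifs with h
    · refine Finset.sum_eq_zero fun d _ => ?_
      rw [if_neg, mul_zero]
      rintro rfl
      simp at h
    · have hsub := PIdx.sub_single_add_single h
      rw [Finset.sum_eq_single (c.1, c.2 - Pi.single i 1)]
      · simp [hsub]
      · intro d _ hd
        rw [if_neg, mul_zero]
        rintro rfl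
        simp at hd
      · intro hd
        rw [hS _ hd, zero_mul]
  rw [jetTotal_eq_sum hS, jetTotal_eq_sum (jetPartial_jetPartial_eq_zero hS c), map_sum, ← hc,
    ← Finset.sum_add_distrib]
  refine Finset.sum_congr rfl fun d _ => ?_
  rw [Derivation.leibniz, jetPartial_coord, jetPartial_comm c d, smul_eq_mul, smul_eq_mul]

/-- The iterated total derivative as a linear endomorphism of the algebra of jet functions. -/
noncomputable def jetMulti (σ : PIdx r) : Module.End ℝ (jetAlgebra r m) :=
  ((List.finRange r).map fun i => jetTotal i ^ σ i).prod

theorem coe_jetTotal_pow (i : Fin r) (n : ℕ) (f : jetAlgebra r m) :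
    (((jetTotal i ^ n) f : jetAlgebra r m) : PJet r m → ℝ) = (ptotalD i)^[n] f := by
  induction n with
  | zero => rfl
  | succ n ih => rw [pow_succ', Function.iterate_succ_apply', ← ih]; rfl

theorem coe_jetMulti (σ : PIdx r) (f : jetAlgebra r m) :
    (jetMulti σ f : PJet r m → ℝ) = pDmulti σ f := by
  unfold jetMulti pDmulti
  induction List.finRange r with
  | nil => rfl
  | cons i l ih =>
    rw [List.map_cons, List.prod_cons, List.foldr_cons, ← ih, ← coe_jetTotal_pow]; rfl

theorem jetMulti_zero : jetMulti (0 : PIdx r) = (1 : Module.End ℝ (jetAlgebra r m)) := by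
  simp [jetMulti]

theorem jetMulti_add_single (σ : PIdx r) (i : Fin r) :
    jetMulti (σ + Pi.single i 1) = (jetTotal i * jetMulti σ : Module.End ℝ (jetAlgebra r m)) := by
  have hcomm : ∀ i j : Fin r, Commute (jetTotal (m := m) i) (jetTotal j) :=
    fun i j => LinearMap.ext (jetTotal_comm i j)
  have key : ∀ l : List (Fin r),
      (l.map fun j => jetTotal (m := m) j ^ (σ + Pi.single i 1 : PIdx r) j).prod =
        jetTotal i ^ l.count i * (l.map fun j => jetTotal j ^ σ j).prod := by
    intro l
    induction l with
    | nil => simp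
    | cons j l ih =>
      rw [List.map_cons, List.prod_cons, List.map_cons, List.prod_cons, ih]
      by_cases h : j = i
      · subst h
        rw [List.count_cons_self, Pi.add_apply, Pi.single_eq_same, ← mul_assoc, ← mul_assoc,
          ← pow_add, ← pow_add]
        congr 2
        omega
      · rw [List.count_cons_of_ne h, Pi.add_apply, Pi.single_eq_of_ne h, add_zero, ← mul_assoc,
          ← mul_assoc, ((hcomm j i).pow_pow _ _).eq]
  rw [jetMulti, key, List.count_eq_one_of_mem (List.nodup_finRange r) (List.mem_finRange i),
    pow_one, jetMulti]

theorem pdeg_add_single (σ : PIdx r) (i : Fin r) : pdeg (σ + Pi.single i 1) = pdeg σ + 1 := by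
  simp [pdeg, Finset.sum_add_distrib]

theorem PIdx.induction {P : PIdx r → Prop} (zero : P 0)
    (add_single : ∀ σ i, P σ → P (σ + Pi.single i 1)) (σ : PIdx r) : P σ := by
  induction h : pdeg σ generalizing σ with
  | zero =>
    have : σ = 0 := by
      funext i
      simpa using (Finset.sum_eq_zero_iff.mp h) i (Finset.mem_univ i)
    exact this ▸ zero
  | succ n ih =>
    obtain ⟨i, hi⟩ : ∃ i, σ i ≠ 0 := by
      by_contra! hσ
      simp [pdeg, hσ] at h
    have hsub := PIdx.sub_single_add_single hi
    rw [← hsub, pdeg_add_single] at h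
    rw [← hsub]
    exact add_single _ _ (ih _ (by omega))

theorem jetMulti_jetTotal (σ : PIdx r) (i : Fin r) (f : jetAlgebra r m) :
    jetMulti σ (jetTotal i f) = jetTotal i (jetMulti σ f) := by
  induction σ using PIdx.induction with
  | zero => simp [jetMulti_zero]
  | add_single σ j ih =>
    rw [jetMulti_add_single, Module.End.mul_apply, ih, jetTotal_comm, Module.End.mul_apply]

theorem jetMulti_coord (σ : PIdx r) (c : Fin m × PIdx r) :
    jetMulti σ (jetCoord c) = jetCoord (c.1, c.2 + σ) := by
  induction σ using PIdx.induction with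
  | zero => simp [jetMulti_zero]
  | add_single σ i ih =>
    rw [jetMulti_add_single, Module.End.mul_apply, ih, jetTotal_coord, add_assoc]

theorem varder_eq_sum {f : jetAlgebra r m} {a : Fin m} {T : Finset (PIdx r)}
    (hT : ∀ σ ∉ T, jetPartial (a, σ) f = 0) :
    varder a f.1 =
      (∑ σ ∈ T, (-1 : ℝ) ^ pdeg σ • jetMulti σ (jetPartial (a, σ) f) : jetAlgebra r m) := by
  funext p
  have h : varder a f.1 p =
      ∑ σ ∈ T, (-1 : ℝ) ^ pdeg σ * pDmulti σ (ppd (a, σ) f.1) p := by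
    refine tsum_eq_sum fun σ hσ => ?_
    rw [← coe_jetPartial, hT σ hσ, ← coe_jetMulti, map_zero]
    simp
  simp [h, coe_jetMulti]

theorem exists_jetPartial_index_eq_zero (f : jetAlgebra r m) :
    ∃ T : Finset (PIdx r), ∀ σ ∉ T, ∀ a, jetPartial (a, σ) f = 0 := by
  obtain ⟨S, hS⟩ := exists_jetPartial_eq_zero f
  refine ⟨S.image Prod.snd, fun σ hσ a => hS _ fun h => hσ ?_⟩
  exact Finset.mem_image_of_mem Prod.snd h

theorem varder_add (a : Fin m) (f g : jetAlgebra r m) :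
    varder a (f + g).1 = varder a f.1 + varder a g.1 := by
  obtain ⟨S, hS⟩ := exists_jetPartial_index_eq_zero f
  obtain ⟨T, hT⟩ := exists_jetPartial_index_eq_zero g
  have hf : ∀ σ ∉ S ∪ T, jetPartial (a, σ) f = 0 := fun c hc => hS c (by simp_all) a
  have hg : ∀ σ ∉ S ∪ T, jetPartial (a, σ) g = 0 := fun c hc => hT c (by simp_all) a
  have hfg : ∀ σ ∉ S ∪ T, jetPartial (a, σ) (f + g) = 0 := fun c hc => by
    rw [map_add, hf c hc, hg c hc, add_zero]
  rw [varder_eq_sum hf, varder_eq_sum hg, varder_eq_sum hfg, ← Subalgebra.coe_add,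
    ← Finset.sum_add_distrib]
  simp only [map_add, smul_add]

theorem varder_smul (a : Fin m) (x : ℝ) (f : jetAlgebra r m) :
    varder a (x • f).1 = x • varder a f.1 := by
  obtain ⟨S, hS⟩ := exists_jetPartial_index_eq_zero f
  have hxf : ∀ σ ∉ S, jetPartial (a, σ) (x • f) = 0 := fun c hc => by
    rw [Derivation.map_smul, hS c hc, smul_zero]
  rw [varder_eq_sum fun σ hσ => hS σ hσ a, varder_eq_sum hxf, ← Subalgebra.coe_smul,
    Finset.smul_sum]
  simp only [Derivation.map_smul, map_smul, smul_comm x]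

/-- The variational derivative annihilates total derivatives. -/
theorem varder_jetTotal (a : Fin m) (i : Fin r) (f : jetAlgebra r m) :
    varder a (jetTotal i f).1 = 0 := by
  obtain ⟨T, hT⟩ := exists_jetPartial_index_eq_zero f
  have hinj : Function.Injective fun σ : PIdx r => σ + Pi.single i 1 := add_left_injective _
  set e : PIdx r ↪ PIdx r := ⟨_, hinj⟩
  set g : PIdx r → jetAlgebra r m := fun σ =>
    (-1 : ℝ) ^ pdeg σ • jetMulti (σ + Pi.single i 1) (jetPartial (a, σ) f) with hg
  set h : PIdx r → jetAlgebra r m := fun σ =>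
    if σ i = 0 then 0 else g (σ - Pi.single i 1) with hh
  have hgT : ∀ σ ∉ T, g σ = 0 := fun σ hσ => by simp [hg, hT σ hσ]
  have hhe : ∀ σ, h (e σ) = g σ := fun σ => by simp [hh, e]
  have hsub : ∀ σ : PIdx r, σ i ≠ 0 → σ - Pi.single i 1 + Pi.single i 1 = σ :=
    fun _ => PIdx.sub_single_add_single
  have hhT : ∀ σ ∉ T.map e, h σ = 0 := fun σ hσ => by
    by_cases h0 : σ i = 0
    · simp [hh, h0]
    · simp only [hh, if_neg h0]
      exact hgT _ fun hmem => hσ (Finset.mem_map.mpr ⟨_, hmem, hsub σ h0⟩)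
  have hterm : ∀ σ, (-1 : ℝ) ^ pdeg σ • jetMulti σ (jetPartial (a, σ) (jetTotal i f)) =
      g σ - h σ := fun σ => by
    rw [jetPartial_jetTotal, map_add, smul_add, sub_eq_add_neg]
    congr 1
    · simp only [hg]
      rw [jetMulti_add_single, Module.End.mul_apply, jetMulti_jetTotal]
    · by_cases h0 : σ i = 0
      · simp [hh, h0]
      · have hd := pdeg_add_single (σ - Pi.single i 1) i
        rw [hsub σ h0] at hd
        simp only [hh, hg, if_neg h0, hsub σ h0, hd, pow_succ]
        simp
  have hU : ∀ σ ∉ T ∪ T.map e, jetPartial (a, σ) (jetTotal i f) = 0 := fun σ hσ => by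
    rw [Finset.mem_union, not_or] at hσ
    rw [jetPartial_jetTotal, hT σ hσ.1, map_zero, zero_add]
    split_ifs with h0
    · rfl
    · exact hT _ (fun hmem => hσ.2 (Finset.mem_map.mpr ⟨_, hmem, hsub σ h0⟩)) a
  rw [varder_eq_sum hU, Finset.sum_congr rfl fun σ _ => hterm σ, Finset.sum_sub_distrib,
    ← Finset.sum_subset Finset.subset_union_left fun σ _ hσ => hgT σ hσ,
    ← Finset.sum_subset Finset.subset_union_right fun σ _ hσ => hhT σ hσ, Finset.sum_map]
  simp [hhe]

variable (r m) in
/-- The submodule of null Lagrangians: those with vanishing variational derivatives. -/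
def nullLagrangian : Submodule ℝ (jetAlgebra r m) where
  carrier := {f | ∀ a, varder a f.1 = 0}
  add_mem' {f g} hf hg a := by rw [varder_add, hf a, hg a, add_zero]
  zero_mem' a := by simpa using varder_smul a 0 (0 : jetAlgebra r m)
  smul_mem' x f hf a := by rw [varder_smul, hf a, smul_zero]

/-- Integration by parts, modulo null Lagrangians. -/
theorem smul_mul_jetMulti_sub_mem_nullLagrangian (σ : PIdx r) (f g : jetAlgebra r m) :
    (-1 : ℝ) ^ pdeg σ • (f * jetMulti σ g) - jetMulti σ f * g ∈ nullLagrangian r m := by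
  induction σ using PIdx.induction generalizing f with
  | zero => simp [jetMulti_zero, pdeg]
  | add_single σ i ih =>
    have h : jetTotal i (f * jetMulti σ g) ∈ nullLagrangian r m :=
      fun a => varder_jetTotal a i _
    rw [jetTotal_mul] at h
    convert sub_mem (ih (jetTotal i f)) (Submodule.smul_mem _ ((-1 : ℝ) ^ pdeg σ) h) using 1
    rw [jetMulti_add_single, Module.End.mul_apply, Module.End.mul_apply, jetMulti_jetTotal,
      pdeg_add_single, pow_succ]
    module

/-- A multi-index in `r` parameters, regarded as a multi-index in `r + 1` parameters. -/
def PIdx.lift (σ : PIdx r) : PIdx (r + 1) := Fin.snoc σ 0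

theorem PIdx.lift_injective : Function.Injective (PIdx.lift (r := r)) :=
  fun _ _ h => (Fin.snoc_inj.mp h).1

theorem PIdx.lift_add_single (σ : PIdx r) (i : Fin r) :
    (σ + Pi.single i 1 : PIdx r).lift = σ.lift + Pi.single i.castSucc 1 := by
  funext j
  refine Fin.lastCases ?_ (fun j => ?_) j
  · simp [PIdx.lift, (Fin.castSucc_lt_last i).ne']
  · simp [PIdx.lift, Pi.single_apply]

theorem PIdx.lift_zero : (0 : PIdx r).lift = 0 := by
  funext j
  refine Fin.lastCases ?_ (fun j => ?_) j <;> simp [PIdx.lift]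

theorem PIdx.pdeg_lift (σ : PIdx r) : pdeg σ.lift = pdeg σ := by
  simp [pdeg, PIdx.lift, Fin.sum_univ_castSucc]

variable (r m) in
/-- The inclusion of jet functions in `r` parameters into jet functions in `r + 1` parameters. -/
def jetLift : jetAlgebra r m →ₐ[ℝ] jetAlgebra (r + 1) m where
  toFun f := ⟨plift f, IsPJetFun.plift f.2⟩
  map_one' := rfl
  map_mul' _ _ := rfl
  map_zero' := rfl
  map_add' _ _ := rfl
  commutes' _ := rfl

theorem jetPartial_jetLift (a : Fin m) (σ : PIdx r) (f : jetAlgebra r m) :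
    jetPartial (a, σ.lift) (jetLift r m f) = jetLift r m (jetPartial (a, σ) f) := by
  have hinj : Function.Injective fun c : Fin m × PIdx r => (c.1, c.2.lift) :=
    fun c d h => Prod.ext (Prod.ext_iff.mp h).1 (PIdx.lift_injective (Prod.ext_iff.mp h).2)
  refine Subtype.ext (funext fun p => ?_)
  have h : ∀ t, plift f.1 (Function.update p (a, σ.lift) t) =
      f.1 (Function.update (fun c => p (c.1, c.2.lift)) (a, σ) t) := fun t =>
    congrArg f.1 (Function.update_comp_eq_of_injective p hinj (a, σ) t)
  change deriv (fun t => plift f.1 (Function.update p (a, σ.lift) t)) _ = _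
  simp only [h]
  rfl

theorem jetPartial_jetLift_eq_zero {c : Fin m × PIdx (r + 1)} (f : jetAlgebra r m)
    (hc : ∀ σ : PIdx r, σ.lift ≠ c.2) : jetPartial c (jetLift r m f) = 0 := by
  refine Subtype.ext (funext fun p => ?_)
  have h : ∀ t, plift f.1 (Function.update p c t) = plift f.1 p := fun t =>
    congrArg f.1 <| funext fun d => Function.update_of_ne
      (fun h => hc d.2 (congrArg Prod.snd h)) _ _
  change deriv (fun t => plift f.1 (Function.update p c t)) _ = _
  simp [h]

theorem jetTotal_jetLift_eq_sum {f : jetAlgebra r m} {T : Finset (PIdx r)}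
    (hT : ∀ σ ∉ T, ∀ a, jetPartial (a, σ) f = 0) (i : Fin (r + 1)) :
    jetTotal i (jetLift r m f) = ∑ a, ∑ σ ∈ T,
      jetCoord (a, σ.lift + Pi.single i 1) * jetLift r m (jetPartial (a, σ) f) := by
  have hS : ∀ c ∉ Finset.univ ×ˢ T.map ⟨_, PIdx.lift_injective⟩,
      jetPartial c (jetLift r m f) = 0 := by
    rintro ⟨a, τ⟩ hc
    by_cases h : ∃ σ : PIdx r, σ.lift = τ
    · obtain ⟨σ, rfl⟩ := h
      rw [jetPartial_jetLift, hT, map_zero]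
      exact fun hσ => hc (Finset.mem_product.mpr ⟨Finset.mem_univ a, Finset.mem_map_of_mem _ hσ⟩)
    · exact jetPartial_jetLift_eq_zero f (not_exists.mp h)
  rw [jetTotal_eq_sum hS, Finset.sum_product]
  simp [jetPartial_jetLift]

theorem jetTotal_jetLift (i : Fin r) (f : jetAlgebra r m) :
    jetTotal i.castSucc (jetLift r m f) = jetLift r m (jetTotal i f) := by
  obtain ⟨T, hT⟩ := exists_jetPartial_index_eq_zero f
  have hS : ∀ c ∉ (Finset.univ : Finset (Fin m)) ×ˢ T, jetPartial c f = 0 :=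
    fun c hc => hT c.2 (by simpa using hc) c.1
  rw [jetTotal_jetLift_eq_sum hT, jetTotal_eq_sum hS, Finset.sum_product]
  simp only [map_sum, map_mul, ← PIdx.lift_add_single]
  rfl

theorem jetMulti_jetLift (σ : PIdx r) (f : jetAlgebra r m) :
    jetMulti σ.lift (jetLift r m f) = jetLift r m (jetMulti σ f) := by
  induction σ using PIdx.induction with
  | zero => simp [PIdx.lift_zero, jetMulti_zero]
  | add_single σ i ih =>
    rw [PIdx.lift_add_single, jetMulti_add_single, jetMulti_add_single, Module.End.mul_apply,
      Module.End.mul_apply, ih, jetTotal_jetLift]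

theorem dbar_eq_sum {f : jetAlgebra r m} {T : Finset (PIdx r)}
    (hT : ∀ σ ∉ T, ∀ a, jetPartial (a, σ) f = 0) :
    dbar f.1 = (∑ a, ∑ σ ∈ T, (-1 : ℝ) ^ pdeg σ.lift • (jetCoord (a, Pi.single (Fin.last r) 1) *
      jetMulti σ.lift (jetLift r m (jetPartial (a, σ) f))) : jetAlgebra (r + 1) m).1 := by
  have h : ∀ a, plift (varder a f.1) = (∑ σ ∈ T, (-1 : ℝ) ^ pdeg σ.lift •
      jetMulti σ.lift (jetLift r m (jetPartial (a, σ) f)) : jetAlgebra (r + 1) m).1 := fun a => by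
    rw [varder_eq_sum fun σ hσ => hT σ hσ a]
    simp only [jetMulti_jetLift, PIdx.pdeg_lift, ← map_smul, ← map_sum]
    rfl
  funext p
  simp only [← mul_smul_comm, ← Finset.mul_sum]
  simp [dbar, h, jetCoord]

/-- The variational differential of `L` is a null Lagrangian: up to total derivatives in the old
parameters, it is the total derivative of `L` in the new one. -/
theorem exists_coe_eq_dbar_mem_nullLagrangian (f : jetAlgebra r m) :
    ∃ g ∈ nullLagrangian (r + 1) m, (g : PJet (r + 1) m → ℝ) = dbar f.1 := by
  obtain ⟨T, hT⟩ := exists_jetPartial_index_eq_zero f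
  refine ⟨_, ?_, (dbar_eq_sum hT).symm⟩
  have h : jetTotal (Fin.last r) (jetLift r m f) ∈ nullLagrangian (r + 1) m :=
    fun a => varder_jetTotal a _ _
  rw [← Submodule.sub_mem_iff_left _ h, jetTotal_jetLift_eq_sum hT, ← Finset.sum_sub_distrib]
  refine sum_mem fun a _ => ?_
  rw [← Finset.sum_sub_distrib]
  refine sum_mem fun σ _ => ?_
  convert smul_mul_jetMulti_sub_mem_nullLagrangian σ.lift
    (jetCoord (a, Pi.single (Fin.last r) 1)) (jetLift r m (jetPartial (a, σ) f)) using 2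
  rw [jetMulti_coord, add_comm σ.lift]

/-- the variational differential squares to zero: `d̄(d̄L) = 0`. -/
theorem dbar_dbar {r m : ℕ} (L : PJet r m → ℝ) (hL : IsPJetFun L) :
    ∀ p : PJet (r + 2) m, dbar (dbar L) p = 0 := by
  intro p
  obtain ⟨g, hg, hgL⟩ := exists_coe_eq_dbar_mem_nullLagrangian ⟨L, hL⟩
  refine Finset.sum_eq_zero fun a _ => ?_
  have h : varder a (dbar L) = 0 := hgL ▸ hg a
  simp [h, plift]
end
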